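/- For every integer n ≥ 3, every real c > 0 and every x ≥ 0, one has (γ(x) + n·c)·x·γ'(x) ≥ 2c·x + γ(x)² − n·c·γ(x), and equality holds if and only if x ≥ x₀. -/

import Mathlib

open Real Filter

noncomputable def alphaF (n : ℕ) (c : ℝ) (x : ℝ) : ℝ :=
  (n : ℝ) * c + ((n : ℝ) / (2 * ((n : ℝ) - 1))) * x
    - (((n : ℝ) - 2) / (2 * ((n : ℝ) - 1))) * Real.sqrt (x ^ 2 + 4 * ((n : ℝ) - 1) * c * x)

noncomputable def yn (n : ℕ) : ℝ :=
  4 * (1 - (n : ℝ)) + (2 * ((n : ℝ) ^ 2 - 4) / Real.sqrt (2 * (n : ℝ) - 5)) *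
    Real.cos ((1 / 3) * Real.arctan (((n : ℝ) ^ 2 - 4 * (n : ℝ) + 6) /
      (2 * ((n : ℝ) - 1) * Real.sqrt (2 * (n : ℝ) - 5))))

noncomputable def x0 (n : ℕ) (c : ℝ) : ℝ := yn n * c

noncomputable def betaF (n : ℕ) (c : ℝ) (x : ℝ) : ℝ :=
  alphaF n c (x0 n c) + deriv (alphaF n c) (x0 n c) * (x - x0 n c)
    + (1 / 2) * deriv (deriv (alphaF n c)) (x0 n c) * (x - x0 n c) ^ 2

noncomputable def gammaF (n : ℕ) (c : ℝ) (x : ℝ) : ℝ :=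
  if x0 n c ≤ x then alphaF n c x else betaF n c x

noncomputable def gammaF' (n : ℕ) (c : ℝ) (x : ℝ) : ℝ :=
  derivWithin (gammaF n c) (Set.Ici 0) x

noncomputable def gammaF'' (n : ℕ) (c : ℝ) (x : ℝ) : ℝ :=
  derivWithin (gammaF' n c) (Set.Ici 0) x

noncomputable def omegaF (n : ℕ) (c : ℝ) (x : ℝ) : ℝ :=
  (x ^ 2 / Real.sqrt (x ^ 2 + 4 * ((n : ℝ) - 1) * c * x)) *
    ((1 + (n : ℝ) ^ 2 * c / x) *
      (((n : ℝ) / ((n : ℝ) - 2) - (1 + 4 * ((n : ℝ) - 1) * c / x) ^ (-(1 / 2) : ℝ)) /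
       ((n : ℝ) / ((n : ℝ) - 2) + (1 + 4 * ((n : ℝ) - 1) * c / x) ^ (-(1 / 2) : ℝ)))) ^ 2

theorem yn_pos (n : ℕ) (hn : 3 ≤ n) : 0 < yn n := by
  have hN : (3 : ℝ) ≤ n := by exact_mod_cast hn
  unfold yn
  generalize (n : ℝ) = N at hN ⊢
  set q := √(2 * N - 5) with hq
  have hq0 : 0 < q := Real.sqrt_pos.2 (by linarith)
  have hq2 : q ^ 2 = 2 * N - 5 := Real.sq_sqrt (by linarith)
  set u := (N ^ 2 - 4 * N + 6) / (2 * (N - 1) * q) with hu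
  have hM : 0 < N ^ 2 - 4 := by nlinarith
  have hm : 0 < N - 1 := by linarith
  have hu0 : 0 < u := div_pos (by nlinarith) (by positivity)
  have hcos : cos (arctan u) = 2 * (N - 1) * q / (N ^ 2 - 4) := by
    have hsq : 1 + u ^ 2 = ((N ^ 2 - 4) / (2 * (N - 1) * q)) ^ 2 := by
      rw [hu]
      field_simp
      rw [hq2]
      ring
    rw [Real.cos_arctan, hsq, Real.sqrt_sq (by positivity), one_div_div]
  have hθ : 0 < arctan u := Real.arctan_pos.2 hu0
  have hlt : cos (arctan u) < cos (1 / 3 * arctan u) :=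
    Real.cos_lt_cos_of_nonneg_of_le_pi (by linarith)
      (by linarith [Real.arctan_lt_pi_div_two u, Real.pi_pos]) (by linarith)
  rw [hcos] at hlt
  have hmul := mul_lt_mul_of_pos_left hlt (show 0 < 2 * (N ^ 2 - 4) / q by positivity)
  have hval : 2 * (N ^ 2 - 4) / q * (2 * (N - 1) * q / (N ^ 2 - 4)) = 4 * (N - 1) := by
    field_simp
    ring
  linarith

theorem x0_pos (n : ℕ) (hn : 3 ≤ n) (c : ℝ) (hc : 0 < c) : 0 < x0 n c :=
  mul_pos (yn_pos n hn) hc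

noncomputable def alphaDeriv (n : ℕ) (c x : ℝ) : ℝ :=
  (n : ℝ) / (2 * ((n : ℝ) - 1)) - (((n : ℝ) - 2) / (2 * ((n : ℝ) - 1))) *
    ((x + 2 * ((n : ℝ) - 1) * c) / √(x ^ 2 + 4 * ((n : ℝ) - 1) * c * x))

section

variable {n : ℕ} {c x : ℝ}

theorem radicand_pos (hn : 3 ≤ n) (hc : 0 < c) (hx : 0 < x) :
    0 < x ^ 2 + 4 * ((n : ℝ) - 1) * c * x := by
  have hN : (3 : ℝ) ≤ n := by exact_mod_cast hn
  have hm : 0 < (n : ℝ) - 1 := by linarith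
  positivity

theorem hasDerivAt_sqrt_radicand (hn : 3 ≤ n) (hc : 0 < c) (hx : 0 < x) :
    HasDerivAt (fun y : ℝ => √(y ^ 2 + 4 * ((n : ℝ) - 1) * c * y))
      ((x + 2 * ((n : ℝ) - 1) * c) / √(x ^ 2 + 4 * ((n : ℝ) - 1) * c * x)) x := by
  have hpos := radicand_pos hn hc hx
  have h := (((hasDerivAt_id x).pow 2).add
    ((hasDerivAt_id x).const_mul (4 * ((n : ℝ) - 1) * c))).sqrt hpos.ne'
  refine h.congr_deriv ?_
  have hs := Real.sqrt_pos.2 hpos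
  simp only [id, Pi.add_apply, Pi.pow_apply]
  field_simp
  push_cast
  ring

theorem hasDerivAt_alphaF (hn : 3 ≤ n) (hc : 0 < c) (hx : 0 < x) :
    HasDerivAt (alphaF n c) (alphaDeriv n c x) x := by
  have h := (((hasDerivAt_id x).const_mul ((n : ℝ) / (2 * ((n : ℝ) - 1)))).const_add
    ((n : ℝ) * c)).sub ((hasDerivAt_sqrt_radicand hn hc hx).const_mul
      (((n : ℝ) - 2) / (2 * ((n : ℝ) - 1))))
  refine h.congr_deriv ?_
  simp [alphaDeriv]

theorem hasDerivAt_alphaDeriv (hn : 3 ≤ n) (hc : 0 < c) (hx : 0 < x) :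
    HasDerivAt (alphaDeriv n c) (2 * ((n : ℝ) - 2) * ((n : ℝ) - 1) * c ^ 2 /
      √(x ^ 2 + 4 * ((n : ℝ) - 1) * c * x) ^ 3) x := by
  have hpos := radicand_pos hn hc hx
  have hs := Real.sqrt_pos.2 hpos
  have h := ((((hasDerivAt_id x).add_const (2 * ((n : ℝ) - 1) * c)).div
    (hasDerivAt_sqrt_radicand hn hc hx) hs.ne').const_mul
      (((n : ℝ) - 2) / (2 * ((n : ℝ) - 1)))).const_sub ((n : ℝ) / (2 * ((n : ℝ) - 1)))
  refine h.congr_deriv ?_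
  have hs2 := Real.sq_sqrt hpos.le
  have hN : (3 : ℝ) ≤ n := by exact_mod_cast hn
  have hm : (n : ℝ) - 1 ≠ 0 := by linarith
  simp only [id]
  generalize √(x ^ 2 + 4 * ((n : ℝ) - 1) * c * x) = s at *
  field_simp
  rw [hs2]
  ring

theorem deriv_deriv_alphaF (hn : 3 ≤ n) (hc : 0 < c) (hx : 0 < x) :
    deriv (deriv (alphaF n c)) x = 2 * ((n : ℝ) - 2) * ((n : ℝ) - 1) * c ^ 2 /
      √(x ^ 2 + 4 * ((n : ℝ) - 1) * c * x) ^ 3 := by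
  have h : deriv (alphaF n c) =ᶠ[nhds x] alphaDeriv n c := by
    filter_upwards [lt_mem_nhds hx] with y hy
    exact (hasDerivAt_alphaF hn hc hy).deriv
  rw [h.deriv_eq, (hasDerivAt_alphaDeriv hn hc hx).deriv]

/-- The substitution `x = 4(n-1)c t²/(1-t²)` rationalises `α` and its derivatives. -/
theorem exists_rational_parametrization (hn : 3 ≤ n) (hc : 0 < c) (hx : 0 < x) :
    ∃ t : ℝ, 0 < t ∧ t < 1 ∧ x = 4 * ((n : ℝ) - 1) * c * t ^ 2 / (1 - t ^ 2) ∧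
      alphaF n c x = c * ((n * (1 + t ^ 2) - 2 * (n - 2) * t) / (1 - t ^ 2)) ∧
      x * alphaDeriv n c x =
        c * ((2 * n * t ^ 2 - (n - 2) * t * (1 + t ^ 2)) / (1 - t ^ 2)) ∧
      x ^ 2 * deriv (deriv (alphaF n c)) x = c * ((n - 2) * t * (1 - t ^ 2) / 2) := by
  have hN : (3 : ℝ) ≤ n := by exact_mod_cast hn
  have hm : 0 < (n : ℝ) - 1 := by linarith
  have hpos := radicand_pos hn hc hx
  have hs := Real.sqrt_pos.2 hpos
  have hs2 := Real.sq_sqrt hpos.le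
  rw [deriv_deriv_alphaF hn hc hx]
  unfold alphaF alphaDeriv
  generalize √(x ^ 2 + 4 * ((n : ℝ) - 1) * c * x) = s at *
  have hxs : x < s := by
    have : 0 < 4 * ((n : ℝ) - 1) * c * x := by positivity
    nlinarith
  obtain ⟨t, rfl⟩ : ∃ t, x = s * t := ⟨x / s, by field_simp⟩
  have ht0 : 0 < t := pos_of_mul_pos_right hx hs.le
  have ht1 : t < 1 := by nlinarith
  have hD : 0 < 1 - t ^ 2 := by nlinarith
  have hsD : s = 4 * ((n : ℝ) - 1) * c * t / (1 - t ^ 2) := by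
    rw [eq_div_iff hD.ne']
    apply mul_left_cancel₀ hs.ne'
    linear_combination hs2
  refine ⟨t, ht0, ht1, ?_, ?_, ?_, ?_⟩ <;> rw [hsD] <;> field_simp <;> ring

theorem alphaF_ode (hn : 3 ≤ n) (hc : 0 < c) (hx : 0 < x) :
    (alphaF n c x + (n : ℝ) * c) * x * alphaDeriv n c x =
      2 * c * x + (alphaF n c x) ^ 2 - (n : ℝ) * c * alphaF n c x := by
  obtain ⟨t, ht0, ht1, hxt, hA, hB, -⟩ := exists_rational_parametrization hn hc hx
  have hD : 0 < 1 - t ^ 2 := by nlinarith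
  rw [mul_assoc, hB, hA, hxt]
  field_simp
  ring

/-- Strict inequality for the second order Taylor polynomial of `α` at `a`. -/
theorem taylor_alphaF_strict {a : ℝ} (hn : 3 ≤ n) (hc : 0 < c) (ha : 0 < a)
    (hx : 0 ≤ x) (hxa : x < a) :
    let A' := alphaDeriv n c a
    let A'' := deriv (deriv (alphaF n c)) a
    let b := alphaF n c a + A' * (x - a) + (1 / 2) * A'' * (x - a) ^ 2
    2 * c * x + b ^ 2 - n * c * b < (b + n * c) * x * (A' + A'' * (x - a)) := by
  intro A' A'' b
  obtain ⟨t, ht0, ht1, hat, hA, hB, hC⟩ := exists_rational_parametrization hn hc ha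
  have hN : (3 : ℝ) ≤ n := by exact_mod_cast hn
  have hD : 0 < 1 - t ^ 2 := by nlinarith
  obtain ⟨r, hr⟩ : ∃ r, x = a * (1 - r) := ⟨1 - x / a, by field_simp; ring⟩
  have hr0 : 0 < r := by nlinarith
  have hr1 : r ≤ 1 := by nlinarith
  set A : ℝ := (n * (1 + t ^ 2) - 2 * (n - 2) * t) / (1 - t ^ 2) with hAd
  set B : ℝ := (2 * n * t ^ 2 - (n - 2) * t * (1 + t ^ 2)) / (1 - t ^ 2) with hBd
  set C : ℝ := (n - 2) * t * (1 - t ^ 2) / 4 with hCd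
  set y : ℝ := 4 * (n - 1) * t ^ 2 / (1 - t ^ 2) with hyd
  have hay : a = c * y := by rw [hat, hyd]; ring
  have hb : b = c * (A - B * r + C * r ^ 2) := by
    simp only [b, A', A'', hA, hr]
    linear_combination (-r) * hB + r ^ 2 / 2 * hC
  have hxb : x * (A' + A'' * (x - a)) = c * ((1 - r) * (B - 2 * C * r)) := by
    simp only [A', A'', hr]
    linear_combination (1 - r) * hB - (1 - r) * r * hC
  have hE0 : (A + n) * B - 2 * y - A ^ 2 + n * A = 0 := by
    rw [hAd, hBd, hyd]; field_simp; ring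
  have hE1 : -(A + n) * (B + 2 * C) - B * B + 2 * y + 2 * A * B - n * B = 0 := by
    rw [hAd, hBd, hyd, hCd]; field_simp; ring
  have hp : 0 < (n : ℝ) - 2 := by linarith
  have hC0 : 0 < C := by rw [hCd]; positivity
  have hnB : (n : ℝ) + B = (1 + t ^ 2) * (n - (n - 2) * t) / (1 - t ^ 2) := by
    rw [hBd]; field_simp; ring
  have hw : C < (n : ℝ) - (n - 2) * t := by
    have h1 : t * (1 + t) / 4 ≤ 1 := by nlinarith
    have h2 := mul_le_mul_of_nonneg_left h1
      (mul_nonneg hp.le (sub_nonneg.2 ht1.le))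
    have h3 : C = ((n : ℝ) - 2) * (1 - t) * (t * (1 + t) / 4) := by rw [hCd]; ring
    linarith
  have hCB : C < (n : ℝ) + B := by
    rw [hnB, lt_div_iff₀ hD]
    linarith [mul_pos hC0 (pow_pos ht0 2), mul_pos (hC0.trans hw) (pow_pos ht0 2)]
  have hCn : C < n := by linarith [mul_pos hp ht0]
  have hQ : 0 < 3 * ((n : ℝ) + B) - (B + 2 * C) * r + C * r ^ 2 := by
    have h1 : 0 ≤ C * (1 - r) ^ 2 := by positivity
    rcases le_total 0 B with hB0 | hB0
    · linarith [mul_nonneg hB0 (sub_nonneg.2 hr1)]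
    · linarith [mul_nonneg (neg_nonneg.2 hB0) hr0.le]
  have hF : (b + n * c) * x * (A' + A'' * (x - a)) - (2 * c * x + b ^ 2 - n * c * b) =
      c ^ 2 * (C * r ^ 2 * (3 * ((n : ℝ) + B) - (B + 2 * C) * r + C * r ^ 2)) := by
    rw [mul_assoc, hxb, hb, hr, hay]
    linear_combination c ^ 2 * hE0 + c ^ 2 * r * hE1
  have : 0 < c ^ 2 * (C * r ^ 2 * (3 * ((n : ℝ) + B) - (B + 2 * C) * r + C * r ^ 2)) := by
    positivity
  linarith

theorem hasDerivAt_betaF (n : ℕ) (c x : ℝ) :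
    HasDerivAt (betaF n c) (deriv (alphaF n c) (x0 n c) +
      deriv (deriv (alphaF n c)) (x0 n c) * (x - x0 n c)) x := by
  have h := (hasDerivAt_id x).sub_const (x0 n c)
  have h2 := ((h.const_mul (deriv (alphaF n c) (x0 n c))).const_add
    (alphaF n c (x0 n c))).add
      ((h.pow 2).const_mul ((1 / 2) * deriv (deriv (alphaF n c)) (x0 n c)))
  refine h2.congr_deriv ?_
  simp
  ring

theorem gammaF'_of_lt (hx : 0 ≤ x) (hlt : x < x0 n c) :
    gammaF' n c x = deriv (alphaF n c) (x0 n c) +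
      deriv (deriv (alphaF n c)) (x0 n c) * (x - x0 n c) := by
  have h : HasDerivAt (gammaF n c) (deriv (alphaF n c) (x0 n c) +
      deriv (deriv (alphaF n c)) (x0 n c) * (x - x0 n c)) x := by
    refine (hasDerivAt_betaF n c x).congr_of_eventuallyEq ?_
    filter_upwards [gt_mem_nhds hlt] with y hy
    exact if_neg hy.not_ge
  exact h.hasDerivWithinAt.derivWithin (uniqueDiffOn_Ici 0 x hx)

theorem gammaF'_of_le (hn : 3 ≤ n) (hc : 0 < c) (hle : x0 n c ≤ x) :
    gammaF' n c x = alphaDeriv n c x := by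
  have h0 := x0_pos n hn c hc
  have hα := hasDerivAt_alphaF hn hc (h0.trans_le hle)
  have h : HasDerivAt (gammaF n c) (alphaDeriv n c x) x := by
    rcases hle.eq_or_lt with heq | hlt
    · have hr : HasDerivWithinAt (gammaF n c) (alphaDeriv n c x) (Set.Ici x) x :=
        hα.hasDerivWithinAt.congr (fun y hy => if_pos (hle.trans hy)) (if_pos hle)
      have hl : HasDerivWithinAt (gammaF n c) (alphaDeriv n c x) (Set.Iic x) x := by
        have hβ : HasDerivAt (betaF n c) (alphaDeriv n c x) x := by
          refine (hasDerivAt_betaF n c x).congr_deriv ?_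
          rw [heq, hα.deriv, sub_self, mul_zero, add_zero]
        have hx : gammaF n c x = betaF n c x := by
          simp [gammaF, betaF, heq]
        refine hβ.hasDerivWithinAt.congr (fun y hy => ?_) hx
        rcases (Set.mem_Iic.1 hy).eq_or_lt with rfl | hy'
        · exact hx
        · exact if_neg (by rw [heq]; exact hy'.not_ge)
      have hu := hl.union hr
      rwa [Set.Iic_union_Ici, hasDerivWithinAt_univ] at hu
    · refine hα.congr_of_eventuallyEq ?_
      filter_upwards [lt_mem_nhds hlt] with y hy
      exact if_pos hy.le
  exact h.hasDerivWithinAt.derivWithin (uniqueDiffOn_Ici 0 x (h0.le.trans hle))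

end

theorem stmt_4 (n : ℕ) (hn : 3 ≤ n) (c : ℝ) (hc : 0 < c) (x : ℝ) (hx : 0 ≤ x) :
    (gammaF n c x + (n : ℝ) * c) * x * gammaF' n c x ≥
      2 * c * x + (gammaF n c x) ^ 2 - (n : ℝ) * c * gammaF n c x ∧
    ((gammaF n c x + (n : ℝ) * c) * x * gammaF' n c x =
      2 * c * x + (gammaF n c x) ^ 2 - (n : ℝ) * c * gammaF n c x ↔ x0 n c ≤ x) := by
  have h0 := x0_pos n hn c hc
  rcases le_or_gt (x0 n c) x with hle | hlt
  · have h := alphaF_ode hn hc (h0.trans_le hle)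
    rw [gammaF'_of_le hn hc hle, show gammaF n c x = alphaF n c x from if_pos hle]
    exact ⟨h.ge, fun _ => hle, fun _ => h⟩
  · have h := taylor_alphaF_strict hn hc h0 hx hlt
    rw [gammaF'_of_lt hx hlt, show gammaF n c x = betaF n c x from if_neg hlt.not_ge, betaF,
      (hasDerivAt_alphaF hn hc h0).deriv]
    exact ⟨h.le, fun he => absurd he h.ne', fun hle => absurd hle hlt.not_ge⟩
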